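/- Let a ∈ ℝ∖{0}. Then the entire functions f₁(z) = G(ia; iz) and f₂(z) = conj( G(1+ia; i·conj(z)) ) belong to the Hermite–Biehler class: each has no zeros in the upper half plane ℂ⁺ = {Im z > 0}, and satisfies |f(z)| ≥ |f(conj(z))| for all z ∈ ℂ⁺. -/

import Mathlib

open Filter Set

/-- `G(a;ζ) = e^{-ζ/2} ∑_{k≥0} ((a)_k/(k!)²) ζ^k`, where `(a)_k` is the Pochhammer symbol;
this is `₁F₁(a;1;ζ) e^{-ζ/2}`. -/
noncomputable def Gfun (a ζ : ℂ) : ℂ :=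
  Complex.exp (-ζ / 2) *
    ∑' k : ℕ, ((ascPochhammer ℂ k).eval a / ((Nat.factorial k : ℂ)) ^ 2) * ζ ^ k

/-- The Taylor coefficients `(a)_k / (k!)²` of `₁F₁(a;1;·)`. -/
noncomputable def kummerCoeff (a : ℂ) (k : ℕ) : ℂ :=
  (ascPochhammer ℂ k).eval a / ((Nat.factorial k : ℂ)) ^ 2

lemma Gfun_eq (a ζ : ℂ) :
    Gfun a ζ = Complex.exp (-ζ / 2) * ∑' k : ℕ, kummerCoeff a k * ζ ^ k := rfl

lemma kummerCoeff_zero (a : ℂ) : kummerCoeff a 0 = 1 := by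
  simp [kummerCoeff]

lemma kummerCoeff_succ (a : ℂ) (k : ℕ) :
    kummerCoeff a (k + 1) = kummerCoeff a k * (a + k) / (k + 1) ^ 2 := by
  have h1 : (Nat.factorial k : ℂ) ≠ 0 := by exact_mod_cast k.factorial_ne_zero
  have h2 : (k + 1 : ℂ) ≠ 0 := by exact_mod_cast k.succ_ne_zero
  simp only [kummerCoeff, ascPochhammer_succ_eval, Nat.factorial_succ]
  push_cast
  field_simp

lemma mul_kummerCoeff_add_one (a : ℂ) (k : ℕ) :
    a * kummerCoeff (a + 1) k = (a + k) * kummerCoeff a k := by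
  induction k with
  | zero => simp [kummerCoeff_zero]
  | succ k ih =>
    rw [kummerCoeff_succ, kummerCoeff_succ]
    push_cast
    linear_combination ((a + 1 + k) / (k + 1) ^ 2) * ih

lemma kummerCoeff_add_one_succ (a : ℂ) (k : ℕ) :
    (k + 1) * kummerCoeff (a + 1) (k + 1) =
      (k + 1) * kummerCoeff a (k + 1) + kummerCoeff (a + 1) k := by
  have h2 : (k + 1 : ℂ) ≠ 0 := by exact_mod_cast k.succ_ne_zero
  have h := mul_kummerCoeff_add_one a k
  rw [kummerCoeff_succ, kummerCoeff_succ]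
  field_simp
  linear_combination h

lemma norm_kummerCoeff_le (a : ℂ) (k : ℕ) :
    ‖kummerCoeff a k‖ ≤ (‖a‖ + 1) ^ k / k.factorial := by
  induction k with
  | zero => simp [kummerCoeff_zero]
  | succ k ih =>
    have hk : (0 : ℝ) < k + 1 := by positivity
    have h1 : ‖a + k‖ ≤ (‖a‖ + 1) * (k + 1) := by
      have := norm_add_le a (k : ℂ)
      rw [Complex.norm_natCast] at this
      nlinarith [norm_nonneg a, mul_nonneg (norm_nonneg a) (Nat.cast_nonneg (α := ℝ) k)]
    have h2 : ‖(k + 1 : ℂ)‖ = k + 1 := by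
      exact_mod_cast Complex.norm_natCast (k + 1)
    rw [kummerCoeff_succ, norm_div, norm_mul, norm_pow, h2, Nat.factorial_succ]
    push_cast
    calc ‖kummerCoeff a k‖ * ‖a + k‖ / (k + 1) ^ 2
        ≤ (‖a‖ + 1) ^ k / k.factorial * ((‖a‖ + 1) * (k + 1)) / (k + 1) ^ 2 := by gcongr
      _ = (‖a‖ + 1) ^ (k + 1) / ((k + 1) * k.factorial) := by
        field_simp
        ring

lemma summable_norm_kummerCoeff_mul_pow (a ζ : ℂ) :
    Summable fun k : ℕ ↦ ‖kummerCoeff a k * ζ ^ k‖ := by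
  refine Summable.of_nonneg_of_le (fun _ ↦ norm_nonneg _) (fun k ↦ ?_)
    (Real.summable_pow_div_factorial ((‖a‖ + 1) * ‖ζ‖))
  rw [norm_mul, norm_pow, mul_pow, mul_div_right_comm]
  gcongr
  exact norm_kummerCoeff_le a k

lemma hasDerivAt_kummerSeries (a ζ : ℂ) :
    HasDerivAt (fun w : ℂ ↦ ∑' k : ℕ, kummerCoeff a k * w ^ k)
      (∑' k : ℕ, (k + 1) * kummerCoeff a (k + 1) * ζ ^ k) ζ := by
  set r : ℝ := ‖ζ‖ + 1
  set R : ℝ := ‖a‖ + 1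
  have hr : 0 ≤ r := by positivity
  have hR : 0 ≤ R := by positivity
  have hu : Summable fun k : ℕ ↦ R ^ k / k.factorial * (k * r ^ (k - 1)) := by
    rw [← summable_nat_add_iff 1]
    refine ((Real.summable_pow_div_factorial (R * r)).mul_left R).congr fun k ↦ ?_
    have : (k.factorial : ℝ) ≠ 0 := by exact_mod_cast k.factorial_ne_zero
    rw [Nat.factorial_succ]
    push_cast
    rw [mul_pow]
    field_simp
    ring
  have hζ : ζ ∈ Metric.ball (0 : ℂ) r := by simp [r]
  have hbd : ∀ (k : ℕ) (w : ℂ), w ∈ Metric.ball (0 : ℂ) r →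
      ‖kummerCoeff a k * (k * w ^ (k - 1))‖ ≤ R ^ k / k.factorial * (k * r ^ (k - 1)) := by
    intro k w hw
    have hw' : ‖w‖ ≤ r := by simpa using (Metric.mem_ball.mp hw).le
    rw [norm_mul, norm_mul, norm_pow, Complex.norm_natCast]
    gcongr
    exact norm_kummerCoeff_le a k
  have key := hasDerivAt_tsum_of_isPreconnected hu Metric.isOpen_ball
    (convex_ball (0 : ℂ) r).isPreconnected
    (g := fun (k : ℕ) (w : ℂ) ↦ kummerCoeff a k * w ^ k)
    (g' := fun (k : ℕ) (w : ℂ) ↦ kummerCoeff a k * (k * w ^ (k - 1)))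
    (fun k w _ ↦ (hasDerivAt_pow k w).const_mul _) hbd hζ
    (summable_norm_kummerCoeff_mul_pow a ζ).of_norm hζ
  refine key.congr_deriv ?_
  rw [(Summable.of_norm_bounded hu fun k ↦ hbd k ζ hζ).tsum_eq_zero_add]
  simp only [Nat.cast_zero, zero_mul, mul_zero, zero_add]
  refine tsum_congr fun k ↦ ?_
  push_cast
  ring

lemma summable_kummerDeriv (a ζ : ℂ) :
    Summable fun k : ℕ ↦ (k + 1) * kummerCoeff a (k + 1) * ζ ^ k := by
  refine Summable.of_norm_bounded
    ((Real.summable_pow_div_factorial ((‖a‖ + 1) * ‖ζ‖)).mul_left (‖a‖ + 1)) fun k ↦ ?_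
  have h1 := norm_kummerCoeff_le a (k + 1)
  have h2 : ‖(k + 1 : ℂ)‖ = k + 1 := by
    exact_mod_cast Complex.norm_natCast (k + 1)
  rw [norm_mul, norm_mul, h2, norm_pow]
  calc (k + 1) * ‖kummerCoeff a (k + 1)‖ * ‖ζ‖ ^ k
      ≤ (k + 1) * ((‖a‖ + 1) ^ (k + 1) / (k + 1).factorial) * ‖ζ‖ ^ k := by gcongr
    _ = (‖a‖ + 1) * (((‖a‖ + 1) * ‖ζ‖) ^ k / k.factorial) := by
      rw [Nat.factorial_succ, mul_pow]
      push_cast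
      field_simp
      ring

/-- `e^{-ζ/2}` times the derivative of `₁F₁(a;1;·)` at `ζ`. -/
noncomputable def kummerDeriv (a ζ : ℂ) : ℂ :=
  Complex.exp (-ζ / 2) * ∑' k : ℕ, (k + 1) * kummerCoeff a (k + 1) * ζ ^ k

lemma hasDerivAt_Gfun (a ζ : ℂ) :
    HasDerivAt (Gfun a) (-Gfun a ζ / 2 + kummerDeriv a ζ) ζ := by
  have h1 : HasDerivAt (fun w : ℂ ↦ Complex.exp (-w / 2))
      (Complex.exp (-ζ / 2) * (-1 / 2)) ζ :=
    (((hasDerivAt_id ζ).neg).div_const 2).cexp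
  refine (h1.mul (hasDerivAt_kummerSeries a ζ)).congr_deriv ?_
  rw [kummerDeriv, Gfun_eq]
  ring

lemma mul_kummerDeriv (a ζ : ℂ) :
    ζ * kummerDeriv a ζ = a * (Gfun (a + 1) ζ - Gfun a ζ) := by
  have hs (b : ℂ) := (summable_norm_kummerCoeff_mul_pow b ζ).of_norm
  have h : ζ * ∑' k : ℕ, (k + 1) * kummerCoeff a (k + 1) * ζ ^ k =
      a * (∑' k : ℕ, kummerCoeff (a + 1) k * ζ ^ k - ∑' k : ℕ, kummerCoeff a k * ζ ^ k) := by
    rw [← (hs (a + 1)).tsum_sub (hs a), ← tsum_mul_left, ← tsum_mul_left,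
      (((hs (a + 1)).sub (hs a)).mul_left a).tsum_eq_zero_add]
    simp only [kummerCoeff_zero, sub_self, mul_zero, zero_add]
    refine tsum_congr fun k ↦ ?_
    have := mul_kummerCoeff_add_one a (k + 1)
    push_cast at this
    linear_combination -ζ ^ (k + 1) * this
  rw [kummerDeriv, Gfun_eq, Gfun_eq]
  linear_combination Complex.exp (-ζ / 2) * h

lemma kummerDeriv_add_one (a ζ : ℂ) :
    kummerDeriv (a + 1) ζ = kummerDeriv a ζ + Gfun (a + 1) ζ := by
  rw [kummerDeriv, kummerDeriv, Gfun_eq, ← mul_add, ← (summable_kummerDeriv a ζ).tsum_add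
    (summable_norm_kummerCoeff_mul_pow (a + 1) ζ).of_norm]
  congr 1
  refine tsum_congr fun k ↦ ?_
  rw [kummerCoeff_add_one_succ]
  ring

lemma Gfun_zero_right (a : ℂ) : Gfun a 0 = 1 := by
  rw [Gfun_eq, tsum_eq_single 0 (by intro k hk; simp [hk])]
  simp [kummerCoeff_zero]

lemma kummerCoeff_eq_multichoose (a : ℂ) (k : ℕ) :
    kummerCoeff a k = Ring.multichoose a k / k.factorial := by
  have h1 : (Nat.factorial k : ℂ) ≠ 0 := by exact_mod_cast k.factorial_ne_zero
  have h := Ring.factorial_nsmul_multichoose_eq_ascPochhammer a k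
  rw [Polynomial.ascPochhammer_smeval_eq_eval, nsmul_eq_mul] at h
  rw [kummerCoeff, ← h]
  field_simp

/-- Kummer's transformation. -/
lemma Gfun_one_sub_neg (a ζ : ℂ) : Gfun (1 - a) (-ζ) = Gfun a ζ := by
  have hexp : Summable fun k : ℕ ↦ ‖ζ ^ k / (k.factorial : ℂ)‖ := by
    simpa using Real.summable_pow_div_factorial ‖ζ‖
  have hE : Complex.exp ζ = ∑' k : ℕ, ζ ^ k / (k.factorial : ℂ) := by
    rw [Complex.exp_eq_exp_ℂ, NormedSpace.exp_eq_tsum_div]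
  have key : (∑' k : ℕ, kummerCoeff (1 - a) k * (-ζ) ^ k) * Complex.exp ζ =
      ∑' k : ℕ, kummerCoeff a k * ζ ^ k := by
    rw [hE, tsum_mul_tsum_eq_tsum_sum_antidiagonal_of_summable_norm
      (summable_norm_kummerCoeff_mul_pow (1 - a) (-ζ)) hexp]
    refine tsum_congr fun n ↦ ?_
    have hV := Ring.add_choose_eq n (Commute.all (-(1 - a)) (n : ℂ))
    rw [show -(1 - a) + (n : ℂ) = a + n - 1 by ring, ← Ring.multichoose_eq] at hV
    rw [kummerCoeff_eq_multichoose, hV, Finset.sum_div, Finset.sum_mul]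
    refine Finset.sum_congr rfl fun ij hij ↦ ?_
    obtain ⟨i, j⟩ := ij
    obtain rfl : i + j = n := by simpa using hij
    have hi : (Nat.factorial i : ℂ) ≠ 0 := by exact_mod_cast i.factorial_ne_zero
    have hj : (Nat.factorial j : ℂ) ≠ 0 := by exact_mod_cast j.factorial_ne_zero
    have hij' : (Nat.factorial (i + j) : ℂ) ≠ 0 := by exact_mod_cast (i + j).factorial_ne_zero
    have hc : ((Nat.choose (i + j) j : ℕ) : ℂ) * i.factorial * j.factorial =
        (i + j).factorial := by
      exact_mod_cast Nat.add_choose_mul_factorial_mul_factorial i j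
    have hs : (Int.negOnePow i : ℤˣ) • Ring.multichoose (1 - a) i =
        (-1) ^ i * Ring.multichoose (1 - a) i := by
      rw [Units.smul_def, zsmul_eq_mul]
      simp [Int.negOnePow_def]
    simp only
    rw [kummerCoeff_eq_multichoose, Ring.choose_neg', Ring.choose_natCast, hs, neg_pow, pow_add]
    field_simp
    linear_combination -Ring.multichoose (1 - a) i * ζ ^ i * ζ ^ j * hc
  rw [Gfun_eq, Gfun_eq, ← key, show -(-ζ) / 2 = -ζ / 2 + ζ by ring, Complex.exp_add]
  ring

lemma conj_kummerCoeff (a : ℂ) (k : ℕ) :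
    (starRingEnd ℂ) (kummerCoeff a k) = kummerCoeff ((starRingEnd ℂ) a) k := by
  induction k with
  | zero => simp [kummerCoeff_zero]
  | succ k ih => simp [kummerCoeff_succ, ih]

lemma conj_Gfun (a ζ : ℂ) :
    (starRingEnd ℂ) (Gfun a ζ) = Gfun ((starRingEnd ℂ) a) ((starRingEnd ℂ) ζ) := by
  rw [Gfun_eq, Gfun_eq, map_mul, ← Complex.exp_conj, Complex.conj_tsum]
  simp [conj_kummerCoeff, Complex.conj_ofNat]

/-- The energy `|G(ia; izt)|² - |G(1 + ia; izt)|²` along the ray `t ≥ 0`. -/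
noncomputable def rayEnergy (a : ℝ) (z : ℂ) (t : ℝ) : ℝ :=
  ‖Gfun (Complex.I * a) (Complex.I * z * t)‖ ^ 2 -
    ‖Gfun (Complex.I * a + 1) (Complex.I * z * t)‖ ^ 2

lemma hasDerivAt_rayEnergy (a : ℝ) (z : ℂ) {t : ℝ} (ht : t ≠ 0) :
    HasDerivAt (rayEnergy a z)
      (z.im * (‖Gfun (Complex.I * a) (Complex.I * z * t)‖ ^ 2 +
        ‖Gfun (Complex.I * a + 1) (Complex.I * z * t)‖ ^ 2)) t := by
  have hlin : HasDerivAt (fun s : ℝ ↦ Complex.I * z * (s : ℂ)) (Complex.I * z) t := by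
    simpa using (Complex.ofRealCLM.hasDerivAt (x := t)).const_mul (Complex.I * z)
  have hu := (hasDerivAt_Gfun (Complex.I * a) (Complex.I * z * t)).comp t hlin
  have hv := (hasDerivAt_Gfun (Complex.I * a + 1) (Complex.I * z * t)).comp t hlin
  have h := hu.norm_sq.sub hv.norm_sq
  refine h.congr_deriv ?_
  have hN := mul_kummerDeriv (Complex.I * a) (Complex.I * z * t)
  rw [kummerDeriv_add_one]
  simp only [Function.comp_apply]
  set u := Gfun (Complex.I * a) (Complex.I * z * t)
  set v := Gfun (Complex.I * a + 1) (Complex.I * z * t)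
  set N := kummerDeriv (Complex.I * a) (Complex.I * z * t)
  have hN' : N * (Complex.I * z) = Complex.I * (a / t : ℝ) * (v - u) := by
    have : (t : ℂ) ≠ 0 := by exact_mod_cast ht
    push_cast
    field_simp
    linear_combination -Complex.I * hN + (N * z * t - a * (v - u)) * Complex.I_sq
  have e1 : (-u / 2 + N) * (Complex.I * z) =
      -(Complex.I * z) * u / 2 + Complex.I * (a / t : ℝ) * (v - u) := by
    linear_combination hN'
  have e2 : (-v / 2 + (N + v)) * (Complex.I * z) =
      (Complex.I * z) * v / 2 + Complex.I * (a / t : ℝ) * (v - u) := by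
    linear_combination hN'
  rw [e1, e2]
  generalize a / t = c
  simp only [Complex.inner, ← Complex.normSq_eq_norm_sq, Complex.normSq_apply]
  simp
  ring

lemma continuous_Gfun_ray (b z : ℂ) :
    Continuous fun t : ℝ ↦ Gfun b (Complex.I * z * t) := by
  have : Continuous (Gfun b) :=
    continuous_iff_continuousAt.mpr fun ζ ↦ (hasDerivAt_Gfun b ζ).continuousAt
  exact this.comp (by fun_prop)

/-- In the upper half plane `|G(1 + ia; iz)| < |G(ia; iz)|`. -/
lemma norm_Gfun_one_add_lt (a : ℝ) {z : ℂ} (hz : 0 < z.im) :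
    ‖Gfun (1 + Complex.I * a) (Complex.I * z)‖ < ‖Gfun (Complex.I * a) (Complex.I * z)‖ := by
  have hcont : Continuous (rayEnergy a z) :=
    ((continuous_Gfun_ray _ z).norm.pow 2).sub ((continuous_Gfun_ray _ z).norm.pow 2)
  have hmono : MonotoneOn (rayEnergy a z) (Ici 0) := by
    refine monotoneOn_of_deriv_nonneg (convex_Ici 0) hcont.continuousOn ?_ ?_
    · intro t ht
      rw [interior_Ici] at ht
      exact (hasDerivAt_rayEnergy a z (ne_of_gt ht)).differentiableAt.differentiableWithinAt
    · intro t ht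
      rw [interior_Ici] at ht
      rw [(hasDerivAt_rayEnergy a z (ne_of_gt ht)).deriv]
      positivity
  have h0 : rayEnergy a z 0 = 0 := by simp [rayEnergy, Gfun_zero_right]
  obtain ⟨δ, hδ, hne⟩ : ∃ δ > 0, ∀ t : ℝ, |t| < δ →
      Gfun (Complex.I * a) (Complex.I * z * t) ≠ 0 := by
    have hev := (continuous_Gfun_ray (Complex.I * a) z).continuousAt (x := 0)|>.eventually_ne
      (y := 0) (by simp [Gfun_zero_right])
    obtain ⟨δ, hδ, h⟩ := Metric.eventually_nhds_iff.mp hev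
    exact ⟨δ, hδ, fun t ht ↦ h (by simpa using ht)⟩
  set ε : ℝ := min δ 1
  have hε : 0 < ε := by positivity
  have hstrict : StrictMonoOn (rayEnergy a z) (Icc 0 ε) := by
    refine strictMonoOn_of_deriv_pos (convex_Icc 0 ε) hcont.continuousOn fun t ht ↦ ?_
    rw [interior_Icc] at ht
    rw [(hasDerivAt_rayEnergy a z (ne_of_gt ht.1)).deriv]
    have := hne t (by rw [abs_of_pos ht.1]; exact ht.2.trans_le (min_le_left _ _))
    positivity
  have h1 : 0 < rayEnergy a z 1 := by
    calc 0 = rayEnergy a z 0 := h0.symm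
      _ < rayEnergy a z ε := hstrict (by simp [hε.le]) (by simp [hε.le]) hε
      _ ≤ rayEnergy a z 1 := hmono hε.le (by simp) (min_le_right _ _)
  rw [rayEnergy, Complex.ofReal_one, mul_one, add_comm _ (1 : ℂ), sub_pos] at h1
  exact lt_of_pow_lt_pow_left₀ 2 (norm_nonneg _) h1

theorem stmt11 (a : ℝ) (ha : a ≠ 0) :
    -- f₁(z) = G(ia; iz) is in the Hermite–Biehler class
    ((∀ z : ℂ, 0 < z.im → Gfun (Complex.I * a) (Complex.I * z) ≠ 0) ∧
      (∀ z : ℂ, 0 < z.im →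
        ‖Gfun (Complex.I * a) (Complex.I * (starRingEnd ℂ) z)‖ ≤
          ‖Gfun (Complex.I * a) (Complex.I * z)‖)) ∧
    -- f₂(z) = conj(G(1+ia; i·conj z)) is in the Hermite–Biehler class
    ((∀ z : ℂ, 0 < z.im →
        (starRingEnd ℂ) (Gfun (1 + Complex.I * a) (Complex.I * (starRingEnd ℂ) z)) ≠ 0) ∧
      (∀ z : ℂ, 0 < z.im →
        ‖(starRingEnd ℂ) (Gfun (1 + Complex.I * a)
            (Complex.I * (starRingEnd ℂ) ((starRingEnd ℂ) z)))‖ ≤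
          ‖(starRingEnd ℂ) (Gfun (1 + Complex.I * a) (Complex.I * (starRingEnd ℂ) z))‖)) := by
  have hf1 (z : ℂ) : ‖Gfun (Complex.I * a) (Complex.I * (starRingEnd ℂ) z)‖ =
      ‖Gfun (1 + Complex.I * a) (Complex.I * z)‖ := by
    rw [← RCLike.norm_conj, conj_Gfun, ← Gfun_one_sub_neg (1 + Complex.I * a)]
    simp
  have hf2 (z : ℂ) : (starRingEnd ℂ) (Gfun (1 + Complex.I * a)
      (Complex.I * (starRingEnd ℂ) z)) = Gfun (Complex.I * a) (Complex.I * z) := by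
    rw [conj_Gfun, ← Gfun_one_sub_neg (Complex.I * a)]
    simp [sub_eq_add_neg]
  have hne (z : ℂ) (hz : 0 < z.im) : Gfun (Complex.I * a) (Complex.I * z) ≠ 0 :=
    norm_pos_iff.mp ((norm_nonneg _).trans_lt (norm_Gfun_one_add_lt a hz))
  have hle (z : ℂ) (hz : 0 < z.im) :
      ‖Gfun (Complex.I * a) (Complex.I * (starRingEnd ℂ) z)‖ ≤
        ‖Gfun (Complex.I * a) (Complex.I * z)‖ :=
    (hf1 z).trans_le (norm_Gfun_one_add_lt a hz).le
  simp only [hf2]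
  exact ⟨⟨hne, hle⟩, hne, hle⟩
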